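/- arXiv:1411.0290 — 3 statements merged into one kernel-verified Lean document; each statement's English description precedes it below -/
import Mathlib

section
/- If G is a connected bipartite finite simple graph and G ∈ N_c, then W_c(G) ≤ 1 + 2·diam(G)·(Δ(G) − 1), where diam(G) is the diameter of G and Δ(G) is its maximum degree. -/
attribute [local instance] Classical.propDecidable

namespace IntervalCyclic

variable {V : Type*}

/-- An interval cyclic `t`-coloring: a proper edge-coloring with colors viewed as
elements of `ZMod t` (representing the colors `1,…,t` cyclically) such that all `t`
colors are used and, at every vertex `v`, the set of colors on the edges incident to
`v` is a set of `d_G(v)` consecutive colors modulo `t`. -/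
def IsIntervalCyclicColoring [Fintype V] (G : SimpleGraph V) (t : ℕ)
    (c : Sym2 V → ZMod t) : Prop :=
  (∀ v w w' : V, G.Adj v w → G.Adj v w' → w ≠ w' → c s(v, w) ≠ c s(v, w')) ∧
  (∀ x : ZMod t, ∃ e ∈ G.edgeSet, c e = x) ∧
  (∀ v : V, ∃ k : ZMod t,
    (G.neighborFinset v).image (fun w => c s(v, w)) =
      (Finset.range (G.degree v)).image (fun i => k + (i : ZMod t)))

/-- `G` has an interval cyclic `t`-coloring for the positive integer `t`. -/
def HasIntervalCyclicColoring [Fintype V] (G : SimpleGraph V) (t : ℕ) : Prop :=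
  0 < t ∧ ∃ c : Sym2 V → ZMod t, IsIntervalCyclicColoring G t c

/-- The greatest `t` for which `G` has an interval cyclic `t`-coloring. -/
noncomputable def Wc [Fintype V] (G : SimpleGraph V) : ℕ :=
  sSup {t | HasIntervalCyclicColoring G t}

/-- The least `t` for which `G` has an interval cyclic `t`-coloring. -/
noncomputable def wc [Fintype V] (G : SimpleGraph V) : ℕ :=
  sInf {t | HasIntervalCyclicColoring G t}

/-- Colors of two edges sharing a vertex of degree at most `D` differ by at most `D - 1`
cyclically. -/
theorem IsIntervalCyclicColoring.exists_color_eq_add_of_adj [Fintype V] {G : SimpleGraph V}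
    {t D : ℕ} {c : Sym2 V → ZMod t} (hc : IsIntervalCyclicColoring G t c)
    {v w w' : V} (hD : G.degree v ≤ D) (hw : G.Adj v w) (hw' : G.Adj v w') :
    ∃ z : ℤ, |z| ≤ ((D - 1 : ℕ) : ℤ) ∧ c s(v, w') = c s(v, w) + z := by
  obtain ⟨k, hk⟩ := hc.2.2 v
  have key (x : V) (hx : G.Adj v x) : ∃ i < G.degree v, k + (i : ZMod t) = c s(v, x) := by
    have hmem : c s(v, x) ∈ (G.neighborFinset v).image (fun w => c s(v, w)) :=
      Finset.mem_image_of_mem _ (by simpa using hx)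
    rw [hk, Finset.mem_image] at hmem
    obtain ⟨a, ha, hax⟩ := hmem
    obtain ⟨i, hi, rfl⟩ : ∃ i < G.degree v, (i : ZMod t) = a := by simpa [eq_comm] using ha
    exact ⟨i, hi, hax⟩
  obtain ⟨i, hi, hiw⟩ := key w hw
  obtain ⟨j, hj, hjw⟩ := key w' hw'
  refine ⟨j - i, ?_, ?_⟩
  · rw [abs_le]
    omega
  · rw [← hiw, ← hjw]
    push_cast
    ring

/-- Colors of two edges whose endpoints are joined by a walk of length `n` differ by at most
`(n + 1) * (D - 1)` cyclically, where `D` bounds all degrees. -/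
theorem IsIntervalCyclicColoring.exists_color_eq_add_of_walk [Fintype V] {G : SimpleGraph V}
    {t D : ℕ} {c : Sym2 V → ZMod t} (hc : IsIntervalCyclicColoring G t c)
    (hD : ∀ v, G.degree v ≤ D) {u x : V} (p : G.Walk u x) {v y : V} (huv : G.Adj u v)
    (hxy : G.Adj x y) :
    ∃ z : ℤ, |z| ≤ (((p.length + 1) * (D - 1) : ℕ) : ℤ) ∧ c s(x, y) = c s(u, v) + z := by
  induction p generalizing v with
  | nil => simpa using hc.exists_color_eq_add_of_adj (hD _) huv hxy
  | @cons a b d h q ih =>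
    obtain ⟨z₁, hz₁, h₁⟩ := hc.exists_color_eq_add_of_adj (hD _) huv h
    obtain ⟨z₂, hz₂, h₂⟩ := ih h.symm hxy
    refine ⟨z₁ + z₂, (abs_add_le _ _).trans ?_, ?_⟩
    · rw [SimpleGraph.Walk.length_cons]
      push_cast at *
      linarith
    · rw [h₂, Sym2.eq_swap, h₁]
      push_cast
      ring

/-- In a connected bipartite graph, adjacent vertices have different distances from any vertex. -/
theorem dist_ne_dist_of_adj {G : SimpleGraph V} (hconn : G.Connected) (hbip : G.Colorable 2)
    (u : V) {x y : V} (hxy : G.Adj x y) : G.dist u x ≠ G.dist u y := by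
  intro h
  obtain ⟨C⟩ := hbip
  let B : G.Coloring Bool := G.recolorOfEquiv finTwoEquiv C
  obtain ⟨p, hp⟩ := hconn.exists_walk_length_eq_dist u x
  obtain ⟨q, hq⟩ := hconn.exists_walk_length_eq_dist u y
  have hpe := B.even_length_iff_congr p
  have hqe := B.even_length_iff_congr q
  rw [hp, h] at hpe
  rw [hq] at hqe
  have hne := B.valid hxy
  grind

theorem HasIntervalCyclicColoring.le [Fintype V] {G : SimpleGraph V} (hconn : G.Connected)
    (hbip : G.Colorable 2) {t D : ℕ} (hD : ∀ v, G.degree v ≤ D)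
    (ht : HasIntervalCyclicColoring G t) : t ≤ 1 + 2 * G.diam * (D - 1) := by
  obtain ⟨hpos, c, hc⟩ := ht
  have : NeZero t := ⟨hpos.ne'⟩
  have := hconn.nonempty
  have hdiam (a b : V) : G.dist a b ≤ G.diam :=
    SimpleGraph.dist_le_diam (SimpleGraph.connected_iff_ediam_ne_top.mp hconn)
  obtain ⟨e, he, -⟩ := hc.2.1 0
  induction e with | _ u v
  have huv : G.Adj u v := he
  have near {x y : V} (hxy : G.Adj x y) (hlt : G.dist u x < G.dist u y) :
      ∃ z : ℤ, |z| ≤ ((G.diam * (D - 1) : ℕ) : ℤ) ∧ c s(x, y) = c s(u, v) + z := by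
    obtain ⟨p, hp⟩ := hconn.exists_walk_length_eq_dist u x
    obtain ⟨z, hz, h⟩ := hc.exists_color_eq_add_of_walk hD p huv hxy
    refine ⟨z, hz.trans ?_, h⟩
    have := hdiam u y
    exact_mod_cast Nat.mul_le_mul_right _ (by omega)
  set N := G.diam * (D - 1) with hN
  have hsub : (Finset.univ : Finset (ZMod t)) ⊆
      (Finset.Icc (-(N : ℤ)) N).image (fun z : ℤ => c s(u, v) + (z : ZMod t)) := by
    intro a _
    obtain ⟨e, he, rfl⟩ := hc.2.1 a
    induction e with | _ x y
    have hxy : G.Adj x y := he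
    obtain ⟨z, hz, h⟩ : ∃ z : ℤ, |z| ≤ (N : ℤ) ∧ c s(x, y) = c s(u, v) + z := by
      rcases lt_or_gt_of_ne (dist_ne_dist_of_adj hconn hbip u hxy) with hlt | hlt
      · exact near hxy hlt
      · rw [Sym2.eq_swap]
        exact near hxy.symm hlt
    exact Finset.mem_image.mpr ⟨z, Finset.mem_Icc.mpr (abs_le.mp hz), h.symm⟩
  have hcard := (Finset.card_le_card hsub).trans Finset.card_image_le
  rw [Finset.card_univ, ZMod.card, Int.card_Icc] at hcard
  rw [mul_assoc, ← hN]
  omega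

/-- If `G` is a connected bipartite finite simple graph and
`G ∈ N_c`, then `W_c(G) ≤ 1 + 2·diam(G)·(Δ(G) − 1)`. Bipartiteness is expressed as
the existence of a partition of the vertices into two independent sets, i.e. a proper
2-coloring of the vertices. -/
theorem stmt_6 {V : Type*} [Fintype V] (G : SimpleGraph V) [DecidableRel G.Adj]
    (hconn : G.Connected) (hbip : G.Colorable 2)
    (hNc : ∃ t, HasIntervalCyclicColoring G t) :
    Wc G ≤ 1 + 2 * G.diam * (G.maxDegree - 1) := by
  refine csSup_le hNc fun t ht => ht.le hconn hbip fun v => ?_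
  convert G.degree_le_maxDegree v

end IntervalCyclic
end

section
/- If G is an interval colorable finite simple graph (G ∈ N), then G is interval cyclically colorable (G ∈ N_c) and every integer t with Δ(G) ≤ t ≤ W(G) belongs to the feasible set F(G), i.e., for every such t the graph G admits an interval cyclic t-coloring. -/
attribute [local instance] Classical.propDecidable

namespace IntervalCyclic

variable {V : Type*}

/-- An interval `t`-coloring: a proper edge-coloring with colors `1,…,t` such that all
`t` colors are used and the colors on the edges incident to each vertex form an
interval of consecutive integers. -/
def IsIntervalColoring [Fintype V] (G : SimpleGraph V) (t : ℕ)
    (c : Sym2 V → ℕ) : Prop :=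
  (∀ v w w' : V, G.Adj v w → G.Adj v w' → w ≠ w' → c s(v, w) ≠ c s(v, w')) ∧
  (∀ e ∈ G.edgeSet, c e ∈ Finset.Icc 1 t) ∧
  (∀ x ∈ Finset.Icc 1 t, ∃ e ∈ G.edgeSet, c e = x) ∧
  (∀ v : V, ∃ k : ℕ,
    (G.neighborFinset v).image (fun w => c s(v, w)) =
      (Finset.range (G.degree v)).image (fun i => k + i))

/-- `G` has an interval `t`-coloring for the positive integer `t`. -/
def HasIntervalColoring [Fintype V] (G : SimpleGraph V) (t : ℕ) : Prop :=
  0 < t ∧ ∃ c : Sym2 V → ℕ, IsIntervalColoring G t c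

/-- The greatest `t` for which `G` has an interval `t`-coloring. -/
noncomputable def W [Fintype V] (G : SimpleGraph V) : ℕ :=
  sSup {t | HasIntervalColoring G t}

/-- Reducing an interval `s`-coloring modulo `t ≤ s` yields an interval cyclic `t`-coloring,
provided `t` is at least every vertex degree. -/
theorem IsIntervalColoring.natCast_isIntervalCyclicColoring [Fintype V] {G : SimpleGraph V}
    {s t : ℕ} {c : Sym2 V → ℕ} (hc : IsIntervalColoring G s c) (ht : 0 < t)
    (hdeg : ∀ v, G.degree v ≤ t) (hts : t ≤ s) :
    IsIntervalCyclicColoring G t (fun e => (c e : ZMod t)) := by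
  obtain ⟨hproper, -, hused, hint⟩ := hc
  have : NeZero t := ⟨ht.ne'⟩
  refine ⟨fun v w w' hw hw' hne heq => ?_, fun x => ?_, fun v => ?_⟩
  · obtain ⟨k, hk⟩ := hint v
    have key : ∀ u, G.Adj v u → ∃ i < t, k + i = c s(v, u) := fun u hu => by
      have hmem : c s(v, u) ∈ (G.neighborFinset v).image (fun w => c s(v, w)) :=
        Finset.mem_image_of_mem _ ((G.mem_neighborFinset v u).2 hu)
      rw [hk, Finset.mem_image] at hmem
      obtain ⟨i, hi, hik⟩ := hmem
      exact ⟨i, (Finset.mem_range.1 hi).trans_le (hdeg v), hik⟩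
    obtain ⟨i, hi, hik⟩ := key w hw
    obtain ⟨j, hj, hjk⟩ := key w' hw'
    apply hproper v w w' hw hw' hne
    have hij : ((k + i : ℕ) : ZMod t) = ((k + j : ℕ) : ZMod t) := by
      rw [hik, hjk]; exact heq
    have hmod : i ≡ j [MOD t] :=
      Nat.ModEq.add_left_cancel' k ((ZMod.natCast_eq_natCast_iff _ _ _).1 hij)
    rw [← hik, ← hjk, hmod.eq_of_lt_of_lt hi hj]
  · by_cases hx : x = 0
    · obtain ⟨e, he, hce⟩ := hused t (Finset.mem_Icc.2 ⟨ht, hts⟩)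
      exact ⟨e, he, by simp [hce, hx]⟩
    · have hpos : 0 < x.val := Nat.pos_of_ne_zero fun h => hx ((ZMod.val_eq_zero x).1 h)
      obtain ⟨e, he, hce⟩ :=
        hused x.val (Finset.mem_Icc.2 ⟨hpos, (ZMod.val_lt x).le.trans hts⟩)
      exact ⟨e, he, by simp [hce]⟩
  · obtain ⟨k, hk⟩ := hint v
    refine ⟨k, ?_⟩
    have := congrArg (Finset.image (Nat.cast : ℕ → ZMod t)) hk
    simpa [Finset.image_image, Function.comp_def] using this

theorem IsIntervalColoring.degree_le [Fintype V] {G : SimpleGraph V} {s : ℕ} {c : Sym2 V → ℕ}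
    (hc : IsIntervalColoring G s c) (v : V) : G.degree v ≤ s := by
  obtain ⟨hproper, hrange, -, -⟩ := hc
  have hcard : (G.neighborFinset v).card ≤ (Finset.Icc 1 s).card := by
    refine Finset.card_le_card_of_injOn (fun w => c s(v, w)) (fun w hw => ?_)
      fun w hw w' hw' heq => ?_
    · exact hrange _ (by simpa using hw)
    · by_contra hne
      exact hproper v w w' (by simpa using hw) (by simpa using hw') hne heq
  simpa using hcard

theorem IsIntervalColoring.le_card_edgeFinset [Fintype V] {G : SimpleGraph V} {s : ℕ}
    {c : Sym2 V → ℕ} (hc : IsIntervalColoring G s c) : s ≤ G.edgeFinset.card := by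
  have hsub : Finset.Icc 1 s ⊆ G.edgeFinset.image c := fun x hx => by
    obtain ⟨e, he, hce⟩ := hc.2.2.1 x hx
    exact Finset.mem_image.2 ⟨e, by simpa using he, hce⟩
  simpa using (Finset.card_le_card hsub).trans Finset.card_image_le

theorem hasIntervalColoring_W [Fintype V] {G : SimpleGraph V}
    (hN : ∃ t, HasIntervalColoring G t) : HasIntervalColoring G (W G) :=
  Nat.sSup_mem (s := {t | HasIntervalColoring G t}) hN
    ⟨G.edgeFinset.card, fun _ ⟨_, _, hc⟩ => hc.le_card_edgeFinset⟩

theorem HasIntervalColoring.exists_adj [Fintype V] {G : SimpleGraph V} {s : ℕ}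
    (h : HasIntervalColoring G s) : ∃ v w, G.Adj v w := by
  obtain ⟨hs, c, -, -, hused, -⟩ := h
  obtain ⟨e, he, -⟩ := hused 1 (Finset.mem_Icc.2 ⟨le_rfl, hs⟩)
  induction e with
  | h v w => exact ⟨v, w, he⟩

/-- If `G` is an interval colorable finite simple graph (`G ∈ N`),
then `G` is interval cyclically colorable (`G ∈ N_c`) and every integer `t` with
`Δ(G) ≤ t ≤ W(G)` belongs to the feasible set: `G` admits an interval cyclic
`t`-coloring for every such `t`. -/
theorem stmt_8 {V : Type*} [Fintype V] (G : SimpleGraph V) [DecidableRel G.Adj]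
    (hN : ∃ t, HasIntervalColoring G t) :
    (∃ t, HasIntervalCyclicColoring G t) ∧
      ∀ t, G.maxDegree ≤ t → t ≤ W G → HasIntervalCyclicColoring G t := by
  obtain ⟨hpos, c, hc⟩ := hasIntervalColoring_W hN
  refine ⟨⟨W G, hpos, _, hc.natCast_isIntervalCyclicColoring hpos hc.degree_le le_rfl⟩,
    fun t hΔ htW => ?_⟩
  have hdeg : ∀ v, G.degree v ≤ t := fun v => (G.degree_le_maxDegree v).trans hΔ
  obtain ⟨v, w, hvw⟩ := (hasIntervalColoring_W hN).exists_adj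
  have ht : 0 < t := ((G.degree_pos_iff_exists_adj v).2 ⟨w, hvw⟩).trans_le (hdeg v)
  exact ⟨ht, _, hc.natCast_isIntervalCyclicColoring ht (fun v => by convert hdeg v) htW⟩

end IntervalCyclic
end

section
/- Let K_{m,n} be the complete bipartite graph with parts of sizes m and n. If min{m,n} = 1, then w_c(K_{m,n}) = W_c(K_{m,n}) = m + n − 1. If min{m,n} ≥ 2, then every integer t with max{m,n} ≤ t ≤ m + n belongs to the feasible set F(K_{m,n}), i.e., K_{m,n} has an interval cyclic t-coloring for each such t. -/
attribute [local instance] Classical.propDecidable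

namespace IntervalCyclic

variable {V : Type*}

open Finset

theorem card_image_range_add (t d : ℕ) (hd : d ≤ t) (k : ZMod t) :
    ((range d).image (fun i : ℕ => k + (i : ZMod t))).card = d := by
  rw [card_image_of_injOn, card_range]
  intro a ha b hb hab
  have h := (ZMod.natCast_eq_natCast_iff' a b t).1 (add_left_cancel hab)
  simp only [coe_range, Set.mem_Iio] at ha hb
  rwa [Nat.mod_eq_of_lt (ha.trans_le hd), Nat.mod_eq_of_lt (hb.trans_le hd)] at h

/-- A coloring using all colors is interval cyclic as soon as every vertex sees the
required number of consecutive colors. -/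
theorem isIntervalCyclicColoring_of_forall_exists [Fintype V] {G : SimpleGraph V} {t : ℕ}
    {c : Sym2 V → ZMod t} (hdeg : ∀ v, G.degree v ≤ t)
    (hsurj : ∀ x, ∃ e ∈ G.edgeSet, c e = x)
    (hcons : ∀ v, ∃ k : ZMod t, ∀ a < G.degree v, ∃ w, G.Adj v w ∧ c s(v, w) = k + (a : ZMod t)) :
    IsIntervalCyclicColoring G t c := by
  have key : ∀ v, ∃ k : ZMod t, (G.neighborFinset v).image (fun w => c s(v, w)) =
      (range (G.degree v)).image (fun i : ℕ => k + (i : ZMod t)) := by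
    intro v
    obtain ⟨k, hk⟩ := hcons v
    refine ⟨k, (eq_of_subset_of_card_le ?_ ?_).symm⟩
    · intro x hx
      obtain ⟨a, ha, rfl⟩ := mem_image.1 hx
      obtain ⟨w, hw, hc⟩ := hk a (mem_range.1 ha)
      exact mem_image.2 ⟨w, (G.mem_neighborFinset v w).2 hw, hc⟩
    · rw [card_image_range_add t _ (hdeg v) k]
      exact card_image_le
  refine ⟨fun v w w' hw hw' hne heq => hne ?_, hsurj, fun v => ?_⟩
  swap
  · obtain ⟨k, hk⟩ := key v
    exact ⟨k, hk.trans (by ext x; simp [Finset.bind_def, Finset.pure_def, eq_neg_add_iff_add_eq])⟩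
  obtain ⟨k, hk⟩ := key v
  have hcard : ((G.neighborFinset v).image (fun w => c s(v, w))).card =
      (G.neighborFinset v).card := by
    rw [hk, card_image_range_add t _ (hdeg v) k, G.card_neighborFinset_eq_degree]
  exact card_image_iff.1 hcard (by simpa using hw) (by simpa using hw') heq

theorem degree_completeBipartiteGraph_inl {m n : ℕ} (i : Fin m) :
    (completeBipartiteGraph (Fin m) (Fin n)).degree (Sum.inl i) = n := by
  have h : (completeBipartiteGraph (Fin m) (Fin n)).neighborFinset (Sum.inl i) =
      univ.map Function.Embedding.inr := by
    ext (v | v) <;> simp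
  rw [← SimpleGraph.card_neighborFinset_eq_degree, h]
  simp

theorem degree_completeBipartiteGraph_inr {m n : ℕ} (j : Fin n) :
    (completeBipartiteGraph (Fin m) (Fin n)).degree (Sum.inr j) = m := by
  have h : (completeBipartiteGraph (Fin m) (Fin n)).neighborFinset (Sum.inr j) =
      univ.map Function.Embedding.inl := by
    ext (v | v) <;> simp
  rw [← SimpleGraph.card_neighborFinset_eq_degree, h]
  simp

/-- The edge-coloring of a complete bipartite graph given by a matrix of colors. -/
def matrixColoring {α β γ : Type*} [Zero γ] (f : α → β → γ) : Sym2 (α ⊕ β) → γ :=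
  Sym2.lift ⟨fun v w => match v, w with
    | Sum.inl i, Sum.inr j => f i j
    | Sum.inr j, Sum.inl i => f i j
    | _, _ => 0, by rintro (v | v) (w | w) <;> rfl⟩

theorem hasIntervalCyclicColoring_of_matrix {m n t : ℕ} (ht : 0 < t) (hm : m ≤ t) (hn : n ≤ t)
    (f : Fin m → Fin n → ZMod t)
    (hsurj : ∀ a < t, ∃ i j, f i j = (a : ZMod t))
    (hrow : ∀ i, ∃ k : ZMod t, ∀ a < n, ∃ j, f i j = k + (a : ZMod t))
    (hcol : ∀ j, ∃ k : ZMod t, ∀ a < m, ∃ i, f i j = k + (a : ZMod t)) :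
    HasIntervalCyclicColoring (completeBipartiteGraph (Fin m) (Fin n)) t := by
  refine ⟨ht, matrixColoring f, isIntervalCyclicColoring_of_forall_exists ?_ ?_ ?_⟩
  · rintro (i | j)
    · rwa [degree_completeBipartiteGraph_inl]
    · rwa [degree_completeBipartiteGraph_inr]
  · intro x
    have : NeZero t := ⟨ht.ne'⟩
    obtain ⟨i, j, hij⟩ := hsurj x.val x.val_lt
    exact ⟨s(Sum.inl i, Sum.inr j), by simp, hij.trans (ZMod.natCast_zmod_val x)⟩
  · rintro (i | j)
    · obtain ⟨k, hk⟩ := hrow i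
      refine ⟨k, fun a ha => ?_⟩
      rw [degree_completeBipartiteGraph_inl] at ha
      obtain ⟨j, hj⟩ := hk a ha
      exact ⟨Sum.inr j, by simp, hj⟩
    · obtain ⟨k, hk⟩ := hcol j
      refine ⟨k, fun a ha => ?_⟩
      rw [degree_completeBipartiteGraph_inr] at ha
      obtain ⟨i, hi⟩ := hk a ha
      exact ⟨Sum.inl i, by simp, hi⟩

/-- The coloring `(i, j) ↦ i + j` modulo `t`. -/
theorem hasIntervalCyclicColoring_of_lt_add {m n t : ℕ} (hm0 : 0 < m) (hn0 : 0 < n)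
    (hm : m ≤ t) (hn : n ≤ t) (ht : t < m + n) :
    HasIntervalCyclicColoring (completeBipartiteGraph (Fin m) (Fin n)) t := by
  refine hasIntervalCyclicColoring_of_matrix (by omega) hm hn
    (fun i j => ((i : ℕ) : ZMod t) + ((j : ℕ) : ZMod t)) ?_ ?_ ?_
  · intro a ha
    by_cases h : a < m
    · exact ⟨⟨a, h⟩, ⟨0, hn0⟩, by simp⟩
    · refine ⟨⟨m - 1, by omega⟩, ⟨a - (m - 1), by omega⟩, ?_⟩
      rw [← Nat.cast_add]
      exact congrArg _ (by simp only; omega)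
  · exact fun i => ⟨(i : ℕ), fun a ha => ⟨⟨a, ha⟩, rfl⟩⟩
  · exact fun j => ⟨(j : ℕ), fun a ha => ⟨⟨a, ha⟩, add_comm _ _⟩⟩

/-- The coloring `(i, j) ↦ i + j` modulo `m + n`, modified to `(i, 0) ↦ i + n` for `i > 0`. -/
theorem hasIntervalCyclicColoring_add {m n : ℕ} (hm : 2 ≤ m) (hn : 2 ≤ n) :
    HasIntervalCyclicColoring (completeBipartiteGraph (Fin m) (Fin n)) (m + n) := by
  refine hasIntervalCyclicColoring_of_matrix (by omega) (by omega) (by omega)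
    (fun i j => ((if (j : ℕ) = 0 ∧ (i : ℕ) ≠ 0 then (i : ℕ) + n else (i : ℕ) + j : ℕ) :
      ZMod (m + n))) ?_ ?_ ?_
  · intro a ha
    by_cases h : a < n
    · exact ⟨⟨0, by omega⟩, ⟨a, h⟩, by simp⟩
    by_cases h' : a = n
    · refine ⟨⟨1, by omega⟩, ⟨n - 1, by omega⟩, congrArg _ ?_⟩
      grind
    · refine ⟨⟨a - n, by omega⟩, ⟨0, by omega⟩, congrArg _ ?_⟩
      grind
  · intro i
    by_cases hi : (i : ℕ) = 0
    · refine ⟨((0 : ℕ) : ZMod (m + n)), fun a ha => ⟨⟨a, ha⟩, ?_⟩⟩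
      rw [← Nat.cast_add]
      refine congrArg _ ?_
      grind
    · refine ⟨((i + 1 : ℕ) : ZMod (m + n)), fun a ha => ?_⟩
      rw [← Nat.cast_add]
      by_cases h : a + 1 = n
      · refine ⟨⟨0, by omega⟩, congrArg _ ?_⟩
        grind
      · refine ⟨⟨a + 1, by omega⟩, congrArg _ ?_⟩
        grind
  · intro j
    by_cases hj : (j : ℕ) = 0
    · refine ⟨((n + 1 : ℕ) : ZMod (m + n)), fun a ha => ?_⟩
      rw [← Nat.cast_add]
      by_cases h : a + 1 = m
      · refine ⟨⟨0, by omega⟩, ?_⟩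
        have h1 : n + 1 + a = m + n := by omega
        rw [h1, ZMod.natCast_self]
        simp [hj]
      · refine ⟨⟨a + 1, by omega⟩, congrArg _ ?_⟩
        grind
    · refine ⟨((j : ℕ) : ZMod (m + n)), fun a ha => ⟨⟨a, ha⟩, ?_⟩⟩
      rw [← Nat.cast_add]
      refine congrArg _ ?_
      grind

theorem HasIntervalCyclicColoring.degree_le [Fintype V] {G : SimpleGraph V} {t : ℕ}
    (h : HasIntervalCyclicColoring G t) (v : V) : G.degree v ≤ t := by
  obtain ⟨ht, c, hproper, -, -⟩ := h
  have : NeZero t := ⟨ht.ne'⟩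
  rw [← G.card_neighborFinset_eq_degree, ← ZMod.card t, ← card_univ]
  refine card_le_card_of_injOn (fun w => c s(v, w)) (fun _ _ => mem_univ _) ?_
  intro w hw w' hw' heq
  by_contra hne
  exact hproper v w w' (by simpa using hw) (by simpa using hw') hne heq

theorem HasIntervalCyclicColoring.le_mul {m n t : ℕ}
    (h : HasIntervalCyclicColoring (completeBipartiteGraph (Fin m) (Fin n)) t) : t ≤ m * n := by
  obtain ⟨ht, c, -, hsurj, -⟩ := h
  have : NeZero t := ⟨ht.ne'⟩
  have hs : Function.Surjective
      (fun p : Fin m × Fin n => c s(Sum.inl p.1, Sum.inr p.2)) := by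
    intro x
    obtain ⟨e, he, rfl⟩ := hsurj x
    induction e using Sym2.ind with
    | _ v w =>
      rcases v with i | j <;> rcases w with i' | j' <;> simp at he
      · exact ⟨(i, j'), rfl⟩
      · exact ⟨(i', j), congrArg c Sym2.eq_swap⟩
  simpa [ZMod.card] using Fintype.card_le_of_surjective _ hs

theorem hasIntervalCyclicColoring_iff_of_min_eq_one {m n t : ℕ} (h : min m n = 1) :
    HasIntervalCyclicColoring (completeBipartiteGraph (Fin m) (Fin n)) t ↔ t = m + n - 1 := by
  constructor
  · intro ht
    have hle := ht.le_mul
    rcases min_choice m n with h' | h'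
    · obtain rfl : m = 1 := by omega
      have := ht.degree_le (Sum.inl 0)
      rw [degree_completeBipartiteGraph_inl] at this
      omega
    · obtain rfl : n = 1 := by omega
      have := ht.degree_le (Sum.inr 0)
      rw [degree_completeBipartiteGraph_inr] at this
      omega
  · rintro rfl
    exact hasIntervalCyclicColoring_of_lt_add (by omega) (by omega) (by omega) (by omega)
      (by omega)

/-- For the complete bipartite graph `K_{m,n}`: if `min{m,n} = 1`,
then `w_c(K_{m,n}) = W_c(K_{m,n}) = m + n − 1`; if `min{m,n} ≥ 2`, then every
integer `t` with `max{m,n} ≤ t ≤ m + n` belongs to the feasible set, i.e.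
`K_{m,n}` has an interval cyclic `t`-coloring for each such `t`. -/
theorem stmt_14 (m n : ℕ) :
    (min m n = 1 →
      wc (completeBipartiteGraph (Fin m) (Fin n)) = m + n - 1 ∧
      Wc (completeBipartiteGraph (Fin m) (Fin n)) = m + n - 1) ∧
    (2 ≤ min m n → ∀ t : ℕ, max m n ≤ t → t ≤ m + n →
      HasIntervalCyclicColoring (completeBipartiteGraph (Fin m) (Fin n)) t) := by
  refine ⟨fun h => ?_, fun h t hmax ht => ?_⟩
  · have hset : {t | HasIntervalCyclicColoring (completeBipartiteGraph (Fin m) (Fin n)) t} =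
        {m + n - 1} :=
      Set.ext fun t => hasIntervalCyclicColoring_iff_of_min_eq_one h
    rw [wc, Wc, hset]
    exact ⟨csInf_singleton _, csSup_singleton _⟩
  · rcases ht.lt_or_eq with ht | rfl
    · exact hasIntervalCyclicColoring_of_lt_add (by omega) (by omega) (by omega) (by omega) ht
    · exact hasIntervalCyclicColoring_add (by omega) (by omega)

end IntervalCyclic
end
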